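/- Let Q be a relatively congruence-distributive quasivariety such that Q_RFSI is closed under substructures. Then Q has the transferable injections property if and only if Q_RFSI has the transferable injections property. -/

import Mathlib

open FirstOrder Language Set

universe u

namespace Transfer

variable (L : FirstOrder.Language.{u, u})

/-- A bundled `L`-structure with carrier in universe `u`. -/
structure Struc : Type (u + 1) where
  Carrier : Type u
  [str : L.Structure Carrier]

attribute [instance] Struc.str

/-- Product structure on a Pi type. -/
instance piStructure {ι : Type u} (M : ι → Type u) [∀ i, L.Structure (M i)] :
    L.Structure (∀ i, M i) where
  funMap f x i := Structure.funMap f fun j => x j i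
  RelMap r x := ∀ i, Structure.RelMap r fun j => x j i

/-- Product structure on a binary product. -/
instance prodStructure (M N : Type u) [L.Structure M] [L.Structure N] :
    L.Structure (M × N) where
  funMap f x := (Structure.funMap f fun j => (x j).1, Structure.funMap f fun j => (x j).2)
  RelMap r x := Structure.RelMap r (fun j => (x j).1) ∧ Structure.RelMap r (fun j => (x j).2)

variable {L}

/-- The bundled structure on a substructure. -/
abbrev ofSub (B : Struc L) (S : L.Substructure B.Carrier) : Struc L := ⟨S⟩

/-- The kernel of a map, as a set of pairs. -/
def kerSet {α β : Type u} (f : α → β) : Set (α × α) := {p | f p.1 = f p.2}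

/-- The restriction of a binary relation on `B` to a substructure `S`. -/
def restrict {B : Struc L} (S : L.Substructure B.Carrier)
    (Θ : Set (B.Carrier × B.Carrier)) : Set ((ofSub B S).Carrier × (ofSub B S).Carrier) :=
  {p | ((p.1 : B.Carrier), (p.2 : B.Carrier)) ∈ Θ}

/-- The image of a binary relation on a substructure `S` in `B`. -/
def lift {B : Struc L} (S : L.Substructure B.Carrier)
    (Θ : Set ((ofSub B S).Carrier × (ofSub B S).Carrier)) : Set (B.Carrier × B.Carrier) :=
  (fun p => ((p.1 : B.Carrier), (p.2 : B.Carrier))) '' Θ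

/-- The set of `Q`-congruences of `A`: kernels of homomorphisms into members of `Q`. -/
def ConQ (Q : Set (Struc L)) (A : Struc L) : Set (Set (A.Carrier × A.Carrier)) :=
  {θ | ∃ M ∈ Q, ∃ f : A.Carrier →[L] M.Carrier, θ = kerSet f}

/-- The least `Q`-congruence of `A` containing `R`. -/
def cgQ (Q : Set (Struc L)) (A : Struc L) (R : Set (A.Carrier × A.Carrier)) :
    Set (A.Carrier × A.Carrier) :=
  ⋂₀ {θ | θ ∈ ConQ Q A ∧ R ⊆ θ}

/-- The join of two `Q`-congruences in `Con_Q A`. -/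
def joinQ (Q : Set (Struc L)) (A : Struc L) (θ φ : Set (A.Carrier × A.Carrier)) :
    Set (A.Carrier × A.Carrier) :=
  cgQ Q A (θ ∪ φ)

/-- `θ` is a meet-irreducible element of `Con_Q A`. -/
def MeetIrred (Q : Set (Struc L)) (A : Struc L) (θ : Set (A.Carrier × A.Carrier)) : Prop :=
  θ ∈ ConQ Q A ∧
    ∀ θ₁ ∈ ConQ Q A, ∀ θ₂ ∈ ConQ Q A, θ = θ₁ ∩ θ₂ → θ = θ₁ ∨ θ = θ₂

/-- `θ` is a completely meet-irreducible element of `Con_Q A`. -/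
def CompletelyMeetIrred (Q : Set (Struc L)) (A : Struc L)
    (θ : Set (A.Carrier × A.Carrier)) : Prop :=
  θ ∈ ConQ Q A ∧
    ∀ S ⊆ ConQ Q A, θ = ⋂₀ S → θ ∈ S

/-- The class of relatively finitely subdirectly irreducible members of `Q`. -/
def RFSI (Q : Set (Struc L)) : Set (Struc L) :=
  {A | A ∈ Q ∧ MeetIrred Q A (Set.diagonal A.Carrier)}

/-- The class of relatively subdirectly irreducible members of `Q`. -/
def RSI (Q : Set (Struc L)) : Set (Struc L) :=
  {A | A ∈ Q ∧ CompletelyMeetIrred Q A (Set.diagonal A.Carrier)}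

/-- `B` has the `Q`-congruence extension property. -/
def HasQCEP (Q : Set (Struc L)) (B : Struc L) : Prop :=
  ∀ S : L.Substructure B.Carrier, ∀ θ ∈ ConQ Q (ofSub B S),
    ∃ Φ ∈ ConQ Q B, restrict S Φ = θ

/-- A class `K` of members of `Q` has the `Q`-congruence extension property. -/
def ClassQCEP (Q K : Set (Struc L)) : Prop :=
  ∀ B ∈ K, HasQCEP Q B

variable (L)

/-- `Q` is a quasivariety: closed under isomorphisms, substructures, direct products,
and ultraproducts. -/
def IsQuasivariety (Q : Set (Struc L)) : Prop :=
  (∀ A ∈ Q, ∀ B : Struc L, Nonempty (A.Carrier ≃[L] B.Carrier) → B ∈ Q) ∧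
  (∀ B ∈ Q, ∀ S : L.Substructure B.Carrier, ofSub B S ∈ Q) ∧
  (∀ (ι : Type u) (f : ι → Struc L), (∀ i, f i ∈ Q) →
    (⟨∀ i, (f i).Carrier⟩ : Struc L) ∈ Q) ∧
  (∀ (ι : Type u) (f : ι → Struc L) (U : Ultrafilter ι), (∀ i, f i ∈ Q) →
    (⟨(U : Filter ι).Product fun i => (f i).Carrier⟩ : Struc L) ∈ Q)

/-- `V` is a variety: closed under homomorphic images, substructures, and direct products. -/
def IsVariety (V : Set (Struc L)) : Prop :=
  (∀ A ∈ V, ∀ B : Struc L, ∀ f : A.Carrier →[L] B.Carrier, Function.Surjective f → B ∈ V) ∧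
  (∀ B ∈ V, ∀ S : L.Substructure B.Carrier, ofSub B S ∈ V) ∧
  (∀ (ι : Type u) (f : ι → Struc L), (∀ i, f i ∈ V) →
    (⟨∀ i, (f i).Carrier⟩ : Struc L) ∈ V)

variable {L}

/-- `Q` is relatively congruence-distributive: `Con_Q A` is a distributive lattice
for every `A ∈ Q`. -/
def RelCongDist (Q : Set (Struc L)) : Prop :=
  ∀ A ∈ Q, ∀ θ ∈ ConQ Q A, ∀ φ ∈ ConQ Q A, ∀ ψ ∈ ConQ Q A,
    θ ∩ joinQ Q A φ ψ = joinQ Q A (θ ∩ φ) (θ ∩ ψ)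

/-- Relation composition `Θ ∘ Φ = {(a,c) : ∃ b, (a,b) ∈ Φ ∧ (b,c) ∈ Θ}`. -/
def relComp {α : Type u} (Θ Φ : Set (α × α)) : Set (α × α) :=
  {p | ∃ b, (p.1, b) ∈ Φ ∧ (b, p.2) ∈ Θ}

/-- `Q` is relatively congruence-permutable. -/
def RelCongPerm (Q : Set (Struc L)) : Prop :=
  ∀ A ∈ Q, ∀ θ ∈ ConQ Q A, ∀ φ ∈ ConQ Q A, relComp θ φ = relComp φ θ

/-- A class `K` is closed under substructures. -/
def SubClosed (K : Set (Struc L)) : Prop :=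
  ∀ B ∈ K, ∀ S : L.Substructure B.Carrier, ofSub B S ∈ K

/-- A class `K` is closed under isomorphisms. -/
def IsoClosed (K : Set (Struc L)) : Prop :=
  ∀ A ∈ K, ∀ B : Struc L, Nonempty (A.Carrier ≃[L] B.Carrier) → B ∈ K

/-- A universal class: closed under isomorphisms, substructures, and ultraproducts. -/
def IsUniversalClass (K : Set (Struc L)) : Prop :=
  IsoClosed K ∧ SubClosed K ∧
  (∀ (ι : Type u) (f : ι → Struc L) (U : Ultrafilter ι), (∀ i, f i ∈ K) →
    (⟨(U : Filter ι).Product fun i => (f i).Carrier⟩ : Struc L) ∈ K)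

/-- The extension property for a class `K`. -/
def HasEP (K : Set (Struc L)) : Prop :=
  ∀ A ∈ K, ∀ B ∈ K, ∀ C ∈ K,
    ∀ (φB : A.Carrier →[L] B.Carrier) (φC : A.Carrier →[L] C.Carrier),
      Function.Injective φB → Function.Surjective φC →
      ∃ D ∈ K, ∃ (ψB : B.Carrier →[L] D.Carrier) (ψC : C.Carrier →[L] D.Carrier),
        Function.Injective ψC ∧ ∀ a, ψB (φB a) = ψC (φC a)

/-- The one-sided amalgamation property for a class `K`. -/
def Has1AP (K : Set (Struc L)) : Prop :=
  ∀ A ∈ K, ∀ B ∈ K, ∀ C ∈ K,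
    ∀ (φB : A.Carrier →[L] B.Carrier) (φC : A.Carrier →[L] C.Carrier),
      Function.Injective φB → Function.Injective φC →
      ∃ D ∈ K, ∃ (ψB : B.Carrier →[L] D.Carrier) (ψC : C.Carrier →[L] D.Carrier),
        Function.Injective ψC ∧ ∀ a, ψB (φB a) = ψC (φC a)

/-- Every doubly injective span in `K` has an amalgam in `K'`. -/
def HasAmalgamIn (K K' : Set (Struc L)) : Prop :=
  ∀ A ∈ K, ∀ B ∈ K, ∀ C ∈ K,
    ∀ (φB : A.Carrier →[L] B.Carrier) (φC : A.Carrier →[L] C.Carrier),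
      Function.Injective φB → Function.Injective φC →
      ∃ D ∈ K', ∃ (ψB : B.Carrier →[L] D.Carrier) (ψC : C.Carrier →[L] D.Carrier),
        Function.Injective ψB ∧ Function.Injective ψC ∧ ∀ a, ψB (φB a) = ψC (φC a)

/-- The amalgamation property for a class `K`. -/
def HasAP (K : Set (Struc L)) : Prop := HasAmalgamIn K K

/-- The transferable injections property for a class `K`. -/
def HasTIP (K : Set (Struc L)) : Prop :=
  ∀ A ∈ K, ∀ B ∈ K, ∀ C ∈ K,
    ∀ (φB : A.Carrier →[L] B.Carrier) (φC : A.Carrier →[L] C.Carrier),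
      Function.Injective φB →
      ∃ D ∈ K, ∃ (ψB : B.Carrier →[L] D.Carrier) (ψC : C.Carrier →[L] D.Carrier),
        Function.Injective ψC ∧ ∀ a, ψB (φB a) = ψC (φC a)

/-- Every doubly injective span in `K` has a strong amalgam in `K'`. -/
def HasStrongAmalgamIn (K K' : Set (Struc L)) : Prop :=
  ∀ A ∈ K, ∀ B ∈ K, ∀ C ∈ K,
    ∀ (φB : A.Carrier →[L] B.Carrier) (φC : A.Carrier →[L] C.Carrier),
      Function.Injective φB → Function.Injective φC →
      ∃ D ∈ K', ∃ (ψB : B.Carrier →[L] D.Carrier) (ψC : C.Carrier →[L] D.Carrier),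
        Function.Injective ψB ∧ Function.Injective ψC ∧ (∀ a, ψB (φB a) = ψC (φC a)) ∧
        Set.range (fun a => ψB (φB a)) = Set.range ψB ∩ Set.range ψC

/-- The strong amalgamation property for a class `K`. -/
def HasSAP (K : Set (Struc L)) : Prop := HasStrongAmalgamIn K K

/-- `φ : A → B` is an epimorphism in the class `K`. -/
def IsEpiIn (K : Set (Struc L)) {A B : Struc L} (φ : A.Carrier →[L] B.Carrier) : Prop :=
  ∀ C ∈ K, ∀ ψ₁ ψ₂ : B.Carrier →[L] C.Carrier,
    ψ₁.comp φ = ψ₂.comp φ → ψ₁ = ψ₂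

/-- The class `K` has surjective epimorphisms. -/
def HasSE (K : Set (Struc L)) : Prop :=
  ∀ A ∈ K, ∀ B ∈ K, ∀ φ : A.Carrier →[L] B.Carrier,
    IsEpiIn K φ → Function.Surjective φ

/-- A substructure `S` of `B` is a retract of `B`. -/
def IsRetract (B : Struc L) (S : L.Substructure B.Carrier) : Prop :=
  ∃ ψ : B.Carrier →[L] (ofSub B S).Carrier, ∀ a : (ofSub B S).Carrier, ψ (a : B.Carrier) = a


/-- The smallest variety containing `V₁ ∪ V₂`. -/
def varJoin (L : FirstOrder.Language.{u, u}) (V₁ V₂ : Set (Struc L)) : Set (Struc L) :=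
  ⋂₀ {W | IsVariety L W ∧ V₁ ⊆ W ∧ V₂ ⊆ W}

/-- In an algebraic language, a map commuting with the operations is a homomorphism. -/
def homOfMapFun [L.IsAlgebraic] {M N : Type u} [L.Structure M] [L.Structure N] (f : M → N)
    (hf : ∀ (n : ℕ) (F : L.Functions n) (x : Fin n → M),
      f (Structure.funMap F x) = Structure.funMap F (f ∘ x)) : M →[L] N where
  toFun := f
  map_fun' F x := hf _ F x
  map_rel' r := isEmptyElim r

/-- The homomorphism into a product given by its components. -/
def piHom [L.IsAlgebraic] {A : Struc L} {ι : Type u} (M : ι → Struc L)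
    (f : ∀ i, A.Carrier →[L] (M i).Carrier) :
    A.Carrier →[L] (⟨∀ i, (M i).Carrier⟩ : Struc L).Carrier :=
  homOfMapFun (fun a i => f i a) fun _ F x => funext fun i => (f i).map_fun F x

/-- A homomorphism factors through any surjective homomorphism with smaller kernel. -/
theorem exists_hom_factor [L.IsAlgebraic] {A E M : Struc L} (f : A.Carrier →[L] E.Carrier)
    (hf : Function.Surjective f) (g : A.Carrier →[L] M.Carrier)
    (h : ∀ a b, f a = f b → g a = g b) :
    ∃ k : E.Carrier →[L] M.Carrier, ∀ a, k (f a) = g a := by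
  refine ⟨homOfMapFun (fun e => g (Function.surjInv hf e)) fun n F x => ?_, fun a =>
    h _ _ (Function.surjInv_eq hf _)⟩
  have h₁ : g (Function.surjInv hf (Structure.funMap F x)) =
      g (Structure.funMap F (Function.surjInv hf ∘ x)) := by
    apply h
    rw [Function.surjInv_eq hf, f.map_fun]
    congr 1
    funext i
    exact (Function.surjInv_eq hf _).symm
  exact h₁.trans (g.map_fun F _)

/-- Every homomorphism into `M` corestricts to a surjection onto a substructure of `M`. -/
theorem exists_surjective_range {A M : Struc L} (f : A.Carrier →[L] M.Carrier) :
    ∃ (S : L.Substructure M.Carrier) (g : A.Carrier →[L] (ofSub M S).Carrier),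
      Function.Surjective g ∧ ∀ a, (g a : M.Carrier) = f a := by
  refine ⟨f.range, f.codRestrict f.range fun a => ⟨a, rfl⟩, ?_, fun _ => rfl⟩
  rintro ⟨_, a, rfl⟩
  exact ⟨a, rfl⟩

variable {Q : Set (Struc L)}

theorem sInter_mem_conQ [L.IsAlgebraic] (hQ : IsQuasivariety L Q) {A : Struc L}
    {S : Set (Set (A.Carrier × A.Carrier))} (hS : S ⊆ ConQ Q A) : ⋂₀ S ∈ ConQ Q A := by
  choose M hM f hf using fun θ : S => hS θ.2
  refine ⟨_, hQ.2.2.1 S M hM, piHom M f, ?_⟩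
  ext p
  constructor
  · intro hp
    refine funext fun θ => ?_
    have hpθ : p ∈ θ.1 := hp θ.1 θ.2
    rw [hf θ] at hpθ
    exact hpθ
  · intro hp θ hθ
    rw [show θ = _ from hf ⟨θ, hθ⟩]
    exact congrFun hp ⟨θ, hθ⟩

theorem inter_mem_conQ [L.IsAlgebraic] (hQ : IsQuasivariety L Q) {A : Struc L}
    {θ φ : Set (A.Carrier × A.Carrier)} (hθ : θ ∈ ConQ Q A) (hφ : φ ∈ ConQ Q A) :
    θ ∩ φ ∈ ConQ Q A := by
  rw [← sInter_pair]
  exact sInter_mem_conQ hQ (by rintro _ (rfl | rfl) <;> assumption)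

theorem joinQ_mem_conQ [L.IsAlgebraic] (hQ : IsQuasivariety L Q) {A : Struc L}
    (θ φ : Set (A.Carrier × A.Carrier)) : joinQ Q A θ φ ∈ ConQ Q A :=
  sInter_mem_conQ hQ fun _ h => h.1

theorem left_subset_joinQ {A : Struc L} (θ φ : Set (A.Carrier × A.Carrier)) :
    θ ⊆ joinQ Q A θ φ :=
  subset_sInter fun _ h => subset_union_left.trans h.2

theorem right_subset_joinQ {A : Struc L} (θ φ : Set (A.Carrier × A.Carrier)) :
    φ ⊆ joinQ Q A θ φ :=
  subset_sInter fun _ h => subset_union_right.trans h.2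

theorem joinQ_subset {A : Struc L} {θ φ ψ : Set (A.Carrier × A.Carrier)}
    (hψ : ψ ∈ ConQ Q A) (h₁ : θ ⊆ ψ) (h₂ : φ ⊆ ψ) : joinQ Q A θ φ ⊆ ψ :=
  sInter_subset_of_mem ⟨hψ, union_subset h₁ h₂⟩

/-- In a relatively congruence-distributive quasivariety, meet-irreducible relative congruences
are meet-prime. -/
theorem MeetIrred.subset_or_subset [L.IsAlgebraic] (hQ : IsQuasivariety L Q)
    (hd : RelCongDist Q) {A : Struc L} (hA : A ∈ Q) {θ φ ψ : Set (A.Carrier × A.Carrier)}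
    (hθ : MeetIrred Q A θ) (hφ : φ ∈ ConQ Q A) (hψ : ψ ∈ ConQ Q A) (h : φ ∩ ψ ⊆ θ) :
    φ ⊆ θ ∨ ψ ⊆ θ := by
  have h₁ : ψ ∩ joinQ Q A θ φ ⊆ θ := by
    rw [hd A hA ψ hψ θ hθ.1 φ hφ]
    exact joinQ_subset hθ.1 inter_subset_right (inter_comm φ ψ ▸ h)
  have h₂ : joinQ Q A θ φ ∩ joinQ Q A θ ψ ⊆ θ := by
    rw [hd A hA _ (joinQ_mem_conQ hQ θ φ) θ hθ.1 ψ hψ]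
    exact joinQ_subset hθ.1 inter_subset_right (inter_comm ψ _ ▸ h₁)
  rcases hθ.2 _ (joinQ_mem_conQ hQ θ φ) _ (joinQ_mem_conQ hQ θ ψ)
    ((subset_inter (left_subset_joinQ θ φ) (left_subset_joinQ θ ψ)).antisymm h₂) with e | e
  · left
    rw [e]
    exact right_subset_joinQ θ φ
  · right
    rw [e]
    exact right_subset_joinQ θ ψ

/-- The union of a nonempty chain of relative congruences is a relative congruence. -/
theorem sUnion_mem_conQ [L.IsAlgebraic] (hQ : IsQuasivariety L Q) {A : Struc L}
    {S : Set (Set (A.Carrier × A.Carrier))} (hS : S ⊆ ConQ Q A) (hc : IsChain (· ⊆ ·) S)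
    (hne : S.Nonempty) : ⋃₀ S ∈ ConQ Q A := by
  choose M hM f hf using fun θ : S => hS θ.2
  have : Nonempty S := hne.to_subtype
  have : IsDirectedOrder S := ⟨fun θ φ => by
    rcases hc.total θ.2 φ.2 with h | h
    · exact ⟨φ, h, le_rfl⟩
    · exact ⟨θ, le_rfl, h⟩⟩
  let U : Ultrafilter S := Ultrafilter.of Filter.atTop
  have hU (θ : S) : ∀ᶠ φ in (U : Filter S), θ ≤ φ :=
    Ultrafilter.of_le _ (Filter.eventually_ge_atTop θ)
  have key (a b : A.Carrier) :
      ((fun θ => f θ a : ∀ θ, (M θ).Carrier) : (U : Filter S).Product fun θ => (M θ).Carrier) =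
        ((fun θ => f θ b : ∀ θ, (M θ).Carrier) : (U : Filter S).Product fun θ => (M θ).Carrier) ↔
      ∀ᶠ θ in (U : Filter S), f θ a = f θ b := Quotient.eq''
  refine ⟨_, hQ.2.2.2 S M U hM, homOfMapFun
    (fun a => ((fun θ => f θ a : ∀ θ, (M θ).Carrier) :
      (U : Filter S).Product fun θ => (M θ).Carrier)) (fun n F x => ?_), ?_⟩
  · refine Eq.trans ?_ (Ultraproduct.funMap_cast F fun i θ => f θ (x i)).symm
    congr 1
    funext θ
    exact (f θ).map_fun F x
  · ext ⟨a, b⟩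
    refine Iff.trans ?_ (key a b).symm
    constructor
    · rintro ⟨θ, hθ, hab⟩
      filter_upwards [hU ⟨θ, hθ⟩] with φ hφ
      have h : (a, b) ∈ φ.1 := hφ hab
      rw [hf φ] at h
      exact h
    · intro h
      obtain ⟨θ, hθ⟩ := h.exists
      refine ⟨θ.1, θ.2, ?_⟩
      rw [hf θ]
      exact hθ

/-- Relative congruences pull back along homomorphisms. -/
theorem preimage_mem_conQ {A E : Struc L} (f : A.Carrier →[L] E.Carrier)
    {θ : Set (E.Carrier × E.Carrier)} (hθ : θ ∈ ConQ Q E) :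
    Prod.map f f ⁻¹' θ ∈ ConQ Q A := by
  obtain ⟨M, hM, g, rfl⟩ := hθ
  exact ⟨M, hM, g.comp f, rfl⟩

theorem diagonal_mem_conQ {A : Struc L} (hA : A ∈ Q) : diagonal A.Carrier ∈ ConQ Q A :=
  ⟨A, hA, Language.Hom.id L _, rfl⟩

/-- A quotient by a meet-irreducible relative congruence is relatively finitely subdirectly
irreducible. -/
theorem mem_rfsi_of_meetIrred {A E : Struc L} (hE : E ∈ Q) (f : A.Carrier →[L] E.Carrier)
    (hf : Function.Surjective f) (h : MeetIrred Q A (kerSet f)) : E ∈ RFSI Q := by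
  have aux (θ : Set (E.Carrier × E.Carrier)) (hθ : kerSet f = Prod.map f f ⁻¹' θ) :
      diagonal E.Carrier = θ := by
    apply (hf.prodMap hf).preimage_injective
    rw [← hθ]
    rfl
  refine ⟨hE, diagonal_mem_conQ hE, fun θ₁ h₁ θ₂ h₂ e => ?_⟩
  refine (h.2 _ (preimage_mem_conQ f h₁) _ (preimage_mem_conQ f h₂) ?_).imp
    (aux θ₁) (aux θ₂)
  rw [← preimage_inter, ← e]
  rfl

/-- The kernel of a surjection onto a relatively finitely subdirectly irreducible member is
meet-irreducible. -/
theorem meetIrred_kerSet [L.IsAlgebraic] {A E : Struc L} (hE : E ∈ RFSI Q)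
    (f : A.Carrier →[L] E.Carrier) (hf : Function.Surjective f) :
    MeetIrred Q A (kerSet f) := by
  have push (θ) (hθ : θ ∈ ConQ Q A) (hle : kerSet f ⊆ θ) :
      ∃ φ ∈ ConQ Q E, θ = Prod.map f f ⁻¹' φ := by
    obtain ⟨M, hM, g, rfl⟩ := hθ
    obtain ⟨k, hk⟩ := exists_hom_factor f hf g fun a b h => @hle (a, b) h
    refine ⟨_, ⟨M, hM, k, rfl⟩, ?_⟩
    ext p
    simp [kerSet, hk]
  refine ⟨⟨E, hE.1, f, rfl⟩, fun θ₁ h₁ θ₂ h₂ e => ?_⟩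
  obtain ⟨φ₁, hφ₁, rfl⟩ := push θ₁ h₁ (e ▸ inter_subset_left)
  obtain ⟨φ₂, hφ₂, rfl⟩ := push θ₂ h₂ (e ▸ inter_subset_right)
  have hΔ : diagonal E.Carrier = φ₁ ∩ φ₂ := by
    apply (hf.prodMap hf).preimage_injective
    rw [preimage_inter, ← e]
    rfl
  refine (hE.2.2 _ hφ₁ _ hφ₂ hΔ).imp ?_ ?_ <;>
  · intro h
    rw [← h]
    rfl

/-- If `T` is disjoint from the diagonal of `A` and two relative congruences meeting `T` have an
intersection meeting `T`, then some relatively finitely subdirectly irreducible quotient of `A`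
has kernel disjoint from `T`. -/
theorem exists_rfsi_quotient [L.IsAlgebraic] (hQ : IsQuasivariety L Q) {A : Struc L}
    (hA : A ∈ Q) (T : Set (A.Carrier × A.Carrier)) (hT : ∀ p ∈ T, p.1 ≠ p.2)
    (hp : ∀ θ₁ ∈ ConQ Q A, ∀ θ₂ ∈ ConQ Q A, Disjoint (θ₁ ∩ θ₂) T →
      Disjoint θ₁ T ∨ Disjoint θ₂ T) :
    ∃ E ∈ RFSI Q, ∃ f : A.Carrier →[L] E.Carrier, Function.Surjective f ∧
      ∀ p ∈ T, f p.1 ≠ f p.2 := by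
  obtain ⟨θ, -, hθ⟩ := zorn_subset_nonempty {θ | θ ∈ ConQ Q A ∧ Disjoint θ T}
    (fun S hS hc hne => ⟨⋃₀ S,
      ⟨sUnion_mem_conQ hQ (fun _ h => (hS h).1) hc hne,
        disjoint_sUnion_left.2 fun _ h => (hS h).2⟩,
      fun _ => subset_sUnion_of_mem⟩)
    (diagonal A.Carrier) ⟨diagonal_mem_conQ hA, disjoint_right.2 hT⟩
  have hirr : MeetIrred Q A θ := by
    refine ⟨hθ.prop.1, fun θ₁ h₁ θ₂ h₂ e => ?_⟩
    refine (hp θ₁ h₁ θ₂ h₂ (e ▸ hθ.prop.2)).imp (fun h => ?_) fun h => ?_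
    · exact hθ.eq_of_subset ⟨h₁, h⟩ (e ▸ inter_subset_left)
    · exact hθ.eq_of_subset ⟨h₂, h⟩ (e ▸ inter_subset_right)
  obtain ⟨M, hM, g, rfl⟩ := hθ.prop.1
  obtain ⟨S, f, hf, hfg⟩ := exists_surjective_range g
  have hker : kerSet g = kerSet f := by
    ext p
    simp [kerSet, ← hfg]
  refine ⟨ofSub M S, mem_rfsi_of_meetIrred (hQ.2.1 M hM S) f hf (hker ▸ hirr), f, hf, ?_⟩
  intro p hpT he
  have hpg : p ∈ kerSet g := hker ▸ he
  exact disjoint_left.1 hθ.prop.2 hpg hpT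

/-- Points of a member of `Q` are separated by relatively finitely subdirectly irreducible
quotients. -/
theorem exists_rfsi_separating [L.IsAlgebraic] (hQ : IsQuasivariety L Q) {A : Struc L}
    (hA : A ∈ Q) {a b : A.Carrier} (hab : a ≠ b) :
    ∃ E ∈ RFSI Q, ∃ f : A.Carrier →[L] E.Carrier, f a ≠ f b := by
  obtain ⟨E, hE, f, -, h⟩ := exists_rfsi_quotient hQ hA {(a, b)} (by simpa using hab)
    (fun θ₁ _ θ₂ _ h => by
      simp only [disjoint_singleton_right, mem_inter_iff] at h ⊢
      tauto)
  exact ⟨E, hE, f, h (a, b) rfl⟩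

/-- A meet-irreducible relative congruence `θ` of `A` contains the restriction along an embedding
`φ : A → B` of the kernel of a relatively finitely subdirectly irreducible quotient of `B`. -/
theorem exists_rfsi_quotient_of_injective [L.IsAlgebraic] (hQ : IsQuasivariety L Q)
    (hd : RelCongDist Q) {A B : Struc L} (hA : A ∈ Q) (hB : B ∈ Q)
    (φ : A.Carrier →[L] B.Carrier) (hφ : Function.Injective φ)
    {θ : Set (A.Carrier × A.Carrier)} (hθ : MeetIrred Q A θ) :
    ∃ E ∈ RFSI Q, ∃ f : B.Carrier →[L] E.Carrier, Function.Surjective f ∧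
      ∀ a b, f (φ a) = f (φ b) → (a, b) ∈ θ := by
  have hdisj (ψ : Set (B.Carrier × B.Carrier)) :
      Disjoint ψ (Prod.map φ φ '' θᶜ) ↔ Prod.map φ φ ⁻¹' ψ ⊆ θ := by
    rw [disjoint_image_right, disjoint_compl_right_iff_subset]
  have hne : ∀ p ∈ Prod.map φ φ '' θᶜ, p.1 ≠ p.2 := by
    rintro _ ⟨⟨a, b⟩, hn, rfl⟩ he
    obtain ⟨M, -, g, rfl⟩ := hθ.1
    exact hn (congrArg g (hφ he))
  obtain ⟨E, hE, f, hf, h⟩ := exists_rfsi_quotient hQ hB _ hne fun θ₁ h₁ θ₂ h₂ h => by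
    rw [hdisj, preimage_inter] at h
    rw [hdisj, hdisj]
    exact hθ.subset_or_subset hQ hd hA (preimage_mem_conQ φ h₁) (preimage_mem_conQ φ h₂) h
  refine ⟨E, hE, f, hf, fun a b hab => ?_⟩
  by_contra hn
  exact h _ ⟨(a, b), hn, rfl⟩ hab

theorem HasTIP.rfsi [L.IsAlgebraic] (hQ : IsQuasivariety L Q) (hd : RelCongDist Q)
    (h : HasTIP Q) : HasTIP (RFSI Q) := by
  intro A hA B hB C hC φB φC hφB
  obtain ⟨D, hD, ψB, ψC, hψC, hcomm⟩ := h A hA.1 B hB.1 C hC.1 φB φC hφB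
  obtain ⟨E, hE, f, -, hf⟩ := exists_rfsi_quotient_of_injective hQ hd hC.1 hD ψC hψC hC.2
  exact ⟨E, hE, f.comp ψB, f.comp ψC, fun a b hab => hf a b hab, fun a =>
    congrArg f (hcomm a)⟩

/-- If `RFSI Q` has the transferable injections property, then spans of `Q` with injective first
leg and second leg into a member of `RFSI Q` can be completed as in that property. -/
theorem HasTIP.exists_of_rfsi [L.IsAlgebraic] (hQ : IsQuasivariety L Q) (hd : RelCongDist Q)
    (hs : SubClosed (RFSI Q)) (h : HasTIP (RFSI Q)) {A B C : Struc L} (hA : A ∈ Q) (hB : B ∈ Q)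
    (hC : C ∈ RFSI Q) (φB : A.Carrier →[L] B.Carrier) (φC : A.Carrier →[L] C.Carrier)
    (hφB : Function.Injective φB) :
    ∃ D ∈ RFSI Q, ∃ (ψB : B.Carrier →[L] D.Carrier) (ψC : C.Carrier →[L] D.Carrier),
      Function.Injective ψC ∧ ∀ a, ψB (φB a) = ψC (φC a) := by
  obtain ⟨S, g, hg, hgC⟩ := exists_surjective_range φC
  obtain ⟨E, hE, f, -, hf⟩ := exists_rfsi_quotient_of_injective hQ hd hA hB φB hφB
    (meetIrred_kerSet (hs C hC S) g hg)
  obtain ⟨T, k, hk, hkE⟩ := exists_surjective_range (M := E) (f.comp φB)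
  obtain ⟨l, hl⟩ := exists_hom_factor k hk φC fun a b hab => by
    have hfab : f (φB a) = f (φB b) := (hkE a).symm.trans ((congrArg _ hab).trans (hkE b))
    rw [← hgC, ← hgC]
    exact congrArg _ (hf a b hfab)
  obtain ⟨D, hD, ψB, ψC, hψC, hcomm⟩ := h (ofSub E T) (hs E hE T) E hE C hC
    T.subtype.toHom l Subtype.val_injective
  refine ⟨D, hD, ψB.comp f, ψC, hψC, fun a => ?_⟩
  rw [← hl, ← hcomm]
  exact congrArg ψB (hkE a).symm

theorem HasTIP.of_rfsi [L.IsAlgebraic] (hQ : IsQuasivariety L Q) (hd : RelCongDist Q)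
    (hs : SubClosed (RFSI Q)) (h : HasTIP (RFSI Q)) : HasTIP Q := by
  intro A hA B hB C hC φB φC hφB
  have key (p : {p : C.Carrier × C.Carrier // p.1 ≠ p.2}) :
      ∃ D ∈ Q, ∃ (ψB : B.Carrier →[L] D.Carrier) (ψC : C.Carrier →[L] D.Carrier),
        ψC p.1.1 ≠ ψC p.1.2 ∧ ∀ a, ψB (φB a) = ψC (φC a) := by
    obtain ⟨E, hE, f, hf⟩ := exists_rfsi_separating hQ hC p.2
    obtain ⟨D, hD, ψB, ψC, hψC, hcomm⟩ :=
      h.exists_of_rfsi hQ hd hs hA hB hE φB (f.comp φC) hφB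
    exact ⟨D, hD.1, ψB, ψC.comp f, fun e => hf (hψC e), hcomm⟩
  choose D hD ψB ψC hψC hcomm using key
  refine ⟨_, hQ.2.2.1 _ D hD, piHom D ψB, piHom D ψC, fun a b hab => ?_, fun a =>
    funext fun p => hcomm p a⟩
  by_contra hne
  exact hψC ⟨(a, b), hne⟩ (congrFun hab ⟨(a, b), hne⟩)

/-- Theorem 4.3: a relatively congruence-distributive quasivariety `Q` with
`Q_RFSI` closed under substructures has the TIP iff `Q_RFSI` has the TIP. -/
theorem stmt17 (L : FirstOrder.Language.{u, u}) [L.IsAlgebraic]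
    (Q : Set (Struc L)) (hQ : IsQuasivariety L Q) (hd : RelCongDist Q)
    (hs : SubClosed (RFSI Q)) :
    HasTIP Q ↔ HasTIP (RFSI Q) := by
  exact ⟨fun h => h.rfsi hQ hd, fun h => h.of_rfsi hQ hd hs⟩

end Transfer
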